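/- Let g : ℂ → ℂ⁶ be given by g(z) = (1 + z²/2, i(1 − z²/2), −(i√3/2)·z², −(√3/2)·z², z, −i√3·z). Then for every z ∈ ℂ: (i) Σ_{j=0}^{5} g_j(z)² = 0; (ii) |g(z)|² = 2(1 + |z|²)²; (iii) Σ_{j=0}^{5} g_j′(z)² = −2; (iv) ⟨g′(z), g(z)⟩ = 4·conj(z)·(1 + |z|²); and (v) the first derived curve g₁(z) = g′(z) − (⟨g′(z), g(z)⟩/|g(z)|²)·g(z) satisfies |g₁(z)|² = 4. -/

import Mathlib

open Complex

/-- The Hermitian inner product `⟨x, y⟩ = Σⱼ xⱼ · conj(yⱼ)` on `ℂ⁶`. -/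
noncomputable def hermIP (x y : Fin 6 → ℂ) : ℂ :=
  ∑ j : Fin 6, x j * (starRingEnd ℂ) (y j)

/-- The constant-curvature holomorphic curve `f₀⁽²⁾` of equation (4.16). -/
noncomputable def gcurve (z : ℂ) : Fin 6 → ℂ :=
  ![1 + z ^ 2 / 2, I * (1 - z ^ 2 / 2),
    -(I * (Real.sqrt 3 : ℂ) / 2) * z ^ 2,
    -((Real.sqrt 3 : ℂ) / 2) * z ^ 2,
    z, -I * (Real.sqrt 3 : ℂ) * z]

/-- The derivative `g′` of the curve. -/
noncomputable def gcurve' (z : ℂ) : Fin 6 → ℂ :=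
  fun j => deriv (fun w => gcurve w j) z

/-- The first derived (Frenet) curve `g₁ = g′ − (⟨g′, g⟩ / |g|²) · g`. -/
noncomputable def gcurveOne (z : ℂ) : Fin 6 → ℂ :=
  fun j => gcurve' z j - (hermIP (gcurve' z) (gcurve z) / hermIP (gcurve z) (gcurve z)) * gcurve z j

lemma hermIP_self (x : Fin 6 → ℂ) : hermIP x x = ((∑ j, ‖x j‖ ^ 2 : ℝ) : ℂ) := by
  simp [hermIP, mul_conj, normSq_eq_norm_sq]

lemma conj_hermIP (x y : Fin 6 → ℂ) : (starRingEnd ℂ) (hermIP x y) = hermIP y x := by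
  simp [hermIP, mul_comm]

lemma hermIP_sub_smul_self (x y : Fin 6 → ℂ) (c : ℂ) :
    hermIP (fun j => x j - c * y j) (fun j => x j - c * y j) =
      hermIP x x - (starRingEnd ℂ) c * hermIP x y - c * hermIP y x
        + c * (starRingEnd ℂ) c * hermIP y y := by
  simp only [hermIP, map_sub, map_mul, Finset.mul_sum, ← Finset.sum_sub_distrib,
    ← Finset.sum_add_distrib]
  exact Finset.sum_congr rfl fun j _ => by ring

/-- Pythagoras for the component of `x` orthogonal to `y`. -/
lemma hermIP_sub_proj_self (x y : Fin 6 → ℂ) (hy : hermIP y y ≠ 0) :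
    hermIP (fun j => x j - hermIP x y / hermIP y y * y j)
        (fun j => x j - hermIP x y / hermIP y y * y j) =
      hermIP x x - hermIP x y * (starRingEnd ℂ) (hermIP x y) / hermIP y y := by
  rw [hermIP_sub_smul_self, map_div₀, conj_hermIP, conj_hermIP]
  field_simp
  ring

lemma ofReal_sqrt_three_sq : ((Real.sqrt 3 : ℝ) : ℂ) ^ 2 = 3 := by
  rw [← ofReal_pow, Real.sq_sqrt (by norm_num)]
  norm_num

lemma gcurve'_eq (z : ℂ) :
    gcurve' z = ![z, -I * z, -(I * (Real.sqrt 3 : ℂ)) * z, -(Real.sqrt 3 : ℂ) * z,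
      1, -I * (Real.sqrt 3 : ℂ)] := by
  have hsq (a : ℂ) : HasDerivAt (fun w : ℂ => a * w ^ 2) (a * (2 * z)) z := by
    simpa using (hasDerivAt_pow 2 z).const_mul a
  have hhalf : HasDerivAt (fun w : ℂ => w ^ 2 / 2) z z := by
    simpa using (hasDerivAt_pow 2 z).div_const 2
  funext j
  apply HasDerivAt.deriv
  fin_cases j
  · exact hhalf.const_add 1
  · exact ((hhalf.const_sub 1).const_mul I).congr_deriv (by simp)
  · exact (hsq _).congr_deriv (by simp; ring)
  · exact (hsq _).congr_deriv (by simp; ring)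
  · exact hasDerivAt_id z
  · exact ((hasDerivAt_id z).const_mul _).congr_deriv (by simp)

lemma sum_gcurve_sq (z : ℂ) : ∑ j : Fin 6, gcurve z j ^ 2 = 0 := by
  simp [Fin.sum_univ_six, gcurve]
  ring_nf
  simp only [I_sq, ofReal_sqrt_three_sq]
  ring

lemma sum_gcurve'_sq (z : ℂ) : ∑ j : Fin 6, gcurve' z j ^ 2 = -2 := by
  simp [Fin.sum_univ_six, gcurve'_eq, mul_pow, ofReal_sqrt_three_sq]
  ring

lemma hermIP_gcurve_self (z : ℂ) :
    hermIP (gcurve z) (gcurve z) = 2 * (1 + z * (starRingEnd ℂ) z) ^ 2 := by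
  simp [map_ofNat, hermIP, Fin.sum_univ_six, gcurve]
  ring_nf
  simp only [I_sq, ofReal_sqrt_three_sq]
  ring

lemma hermIP_gcurve'_self (z : ℂ) :
    hermIP (gcurve' z) (gcurve' z) = 8 * (z * (starRingEnd ℂ) z) + 4 := by
  simp [hermIP, Fin.sum_univ_six, gcurve'_eq]
  ring_nf
  simp only [I_sq, ofReal_sqrt_three_sq]
  ring

lemma hermIP_gcurve'_gcurve (z : ℂ) :
    hermIP (gcurve' z) (gcurve z) =
      4 * (starRingEnd ℂ) z * (1 + z * (starRingEnd ℂ) z) := by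
  simp [map_ofNat, hermIP, Fin.sum_univ_six, gcurve'_eq, gcurve]
  ring_nf
  simp only [I_sq, ofReal_sqrt_three_sq]
  ring

lemma one_add_mul_conj_ne_zero (z : ℂ) : 1 + z * (starRingEnd ℂ) z ≠ 0 := by
  rw [mul_conj, normSq_eq_norm_sq]
  exact_mod_cast (by positivity : (1 + ‖z‖ ^ 2 : ℝ) ≠ 0)

lemma hermIP_gcurveOne_self (z : ℂ) : hermIP (gcurveOne z) (gcurveOne z) = 4 := by
  have hz := one_add_mul_conj_ne_zero z
  have hg : hermIP (gcurve z) (gcurve z) ≠ 0 := by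
    rw [hermIP_gcurve_self]
    exact mul_ne_zero two_ne_zero (pow_ne_zero 2 hz)
  refine (hermIP_sub_proj_self _ _ hg).trans ?_
  rw [hermIP_gcurve_self, hermIP_gcurve'_self, hermIP_gcurve'_gcurve]
  simp only [map_mul, map_add, map_one, conj_conj, map_ofNat]
  rw [mul_comm ((starRingEnd ℂ) z) z]
  field_simp
  ring

theorem stmt_9 :
    ∀ z : ℂ,
      (∑ j : Fin 6, gcurve z j ^ 2 = 0) ∧
      (∑ j : Fin 6, ‖gcurve z j‖ ^ 2 = 2 * (1 + ‖z‖ ^ 2) ^ 2) ∧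
      (∑ j : Fin 6, (gcurve' z j) ^ 2 = -2) ∧
      hermIP (gcurve' z) (gcurve z) = 4 * (starRingEnd ℂ) z * (((1 + ‖z‖ ^ 2 : ℝ) : ℂ)) ∧
      (∑ j : Fin 6, ‖gcurveOne z j‖ ^ 2 = 4) := by
  intro z
  refine ⟨sum_gcurve_sq z, ?_, sum_gcurve'_sq z, ?_, ?_⟩
  · have h := hermIP_gcurve_self z
    rw [hermIP_self, mul_conj, normSq_eq_norm_sq] at h
    exact_mod_cast h
  · rw [hermIP_gcurve'_gcurve, mul_conj, normSq_eq_norm_sq]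
    push_cast
    rfl
  · have h := hermIP_gcurveOne_self z
    rw [hermIP_self] at h
    exact_mod_cast h
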